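/- arXiv:2106.00748 — 2 statements merged into one kernel-verified Lean document; each statement's English description precedes it below -/
import Mathlib

section
/- Let β > 0. There exist constants C, c > 0 such that for all x, y, t > 0 with xy ≥ t, the derivative of the Bessel heat kernel satisfies |∂_x T_t(x,y)| ≤ C · (x+y)/t^{3/2} · exp(-|x-y|²/(c t)), where T_t(x,y) = (xy)^{1/2}/(2t) · I_{β-1/2}(xy/(2t)) · exp(-(x²+y²)/(4t)). -/
open Real Set MeasureTheory

/-- Modified Bessel function of the first kind (series definition). -/
noncomputable def besselI (ν x : ℝ) : ℝ :=
  ∑' n : ℕ, (x/2) ^ ν * (x/2) ^ (2*n) / (Nat.factorial n * Real.Gamma (n + ν + 1))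

/-- The Bessel heat kernel. -/
noncomputable def TB (β t x y : ℝ) : ℝ :=
  (x*y) ^ ((1:ℝ)/2) / (2*t) * besselI (β - 1/2) (x*y/(2*t)) * Real.exp (-(x^2+y^2)/(4*t))

/-- The entire function `∑ zⁿ / (n! Γ(n + a))`, the regular part of the Bessel function of order
`a - 1`. -/
noncomputable def besselSeries (a z : ℝ) : ℝ :=
  ∑' n : ℕ, z ^ n / (Nat.factorial n * Real.Gamma (n + a))

theorem exists_inv_Gamma_nat_add_le {a : ℝ} (ha : 0 < a) :
    ∃ B : ℝ, 0 < B ∧ ∀ n : ℕ, (Real.Gamma (n + a))⁻¹ ≤ B := by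
  have h0 := Real.Gamma_pos_of_pos ha
  have h1 : 0 < Real.Gamma (1 + a) := Real.Gamma_pos_of_pos (by linarith)
  have hle : ∀ n : ℕ, Real.Gamma (1 + a) ≤ Real.Gamma ((n + 1 : ℕ) + a) := by
    intro n
    induction n with
    | zero => simp
    | succ k ih =>
      have hk : ((k + 1 + 1 : ℕ) : ℝ) + a = ((k + 1 : ℕ) + a) + 1 := by push_cast; ring
      have hpos : 0 < ((k + 1 : ℕ) : ℝ) + a := by positivity
      rw [hk, Real.Gamma_add_one hpos.ne']
      have hone : 1 ≤ ((k + 1 : ℕ) : ℝ) + a := by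
        push_cast
        linarith [(Nat.cast_nonneg k : (0 : ℝ) ≤ k)]
      nlinarith
  refine ⟨(Real.Gamma a)⁻¹ + (Real.Gamma (1 + a))⁻¹, by positivity, ?_⟩
  rintro (_ | n)
  · simpa using h1.le
  · have := inv_anti₀ h1 (hle n)
    have := inv_pos.2 h0
    linarith

theorem norm_besselSeries_term_le {a B : ℝ} (ha : 0 < a)
    (hB : ∀ n : ℕ, (Real.Gamma (n + a))⁻¹ ≤ B) (z : ℝ) (n : ℕ) :
    ‖z ^ n / (Nat.factorial n * Real.Gamma (n + a))‖ ≤ B * (|z| ^ n / Nat.factorial n) := by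
  have hG : 0 < Real.Gamma (n + a) := Real.Gamma_pos_of_pos (by positivity)
  rw [norm_div, norm_pow, Real.norm_eq_abs, Real.norm_of_nonneg (by positivity),
    ← div_div, div_eq_mul_inv _ (Real.Gamma _), mul_comm]
  exact mul_le_mul_of_nonneg_right (hB n) (by positivity)

theorem summable_besselSeries {a : ℝ} (ha : 0 < a) (z : ℝ) :
    Summable fun n : ℕ => z ^ n / (Nat.factorial n * Real.Gamma (n + a)) := by
  obtain ⟨B, -, hB⟩ := exists_inv_Gamma_nat_add_le ha
  exact Summable.of_norm_bounded ((Real.summable_pow_div_factorial |z|).mul_left B)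
    (norm_besselSeries_term_le ha hB z)

theorem natCast_mul_pow_div_succ (a z : ℝ) (n : ℕ) :
    ((n + 1 : ℕ) : ℝ) * z ^ n / (Nat.factorial (n + 1) * Real.Gamma ((n + 1 : ℕ) + a)) =
      z ^ n / (Nat.factorial n * Real.Gamma (n + (a + 1))) := by
  have hcast : ((n + 1 : ℕ) : ℝ) + a = n + (a + 1) := by push_cast; ring
  rw [hcast, Nat.factorial_succ, Nat.cast_mul, mul_assoc, mul_div_mul_left]
  positivity

theorem hasDerivAt_besselSeries {a : ℝ} (ha : 0 < a) (z : ℝ) :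
    HasDerivAt (besselSeries a) (besselSeries (a + 1) z) z := by
  obtain ⟨B, -, hB⟩ := exists_inv_Gamma_nat_add_le (add_pos ha one_pos)
  set R := |z| + 1
  set g' : ℕ → ℝ → ℝ := fun n w => n * w ^ (n - 1) / (Nat.factorial n * Real.Gamma (n + a))
  have hz : z ∈ Metric.ball (0 : ℝ) R := by simp [R]
  have hshift : ∀ (w : ℝ) (n : ℕ), g' (n + 1) w =
      w ^ n / (Nat.factorial n * Real.Gamma (n + (a + 1))) :=
    fun w n => natCast_mul_pow_div_succ a w n
  have hbound : ∀ n w, w ∈ Metric.ball (0 : ℝ) R →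
      ‖g' n w‖ ≤ Nat.casesOn n 0 fun m => B * (R ^ m / Nat.factorial m) := by
    rintro (_ | n) w hw
    · simp [g']
    · rw [hshift]
      refine (norm_besselSeries_term_le (by linarith) hB w n).trans ?_
      have hw' : |w| ≤ R := by simpa using (mem_ball_zero_iff.1 hw).le
      have hB0 : 0 ≤ B := (inv_nonneg.2 (Real.Gamma_nonneg_of_nonneg (by positivity))).trans (hB 0)
      dsimp only
      gcongr
  have hder := hasDerivAt_tsum_of_isPreconnected
    (u := fun n : ℕ => (Nat.casesOn n 0 fun m => B * (R ^ m / Nat.factorial m) : ℝ))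
    (g := fun (n : ℕ) (w : ℝ) => w ^ n / (Nat.factorial n * Real.Gamma (n + a))) (g' := g')
    ((summable_nat_add_iff 1).1 ((Real.summable_pow_div_factorial R).mul_left B))
    Metric.isOpen_ball (convex_ball (0 : ℝ) R).isPreconnected
    (fun n w _ => (hasDerivAt_pow n w).div_const _) hbound hz (summable_besselSeries ha z) hz
  have hsum : Summable fun n => g' n z := by
    rw [← summable_nat_add_iff 1]
    simpa only [hshift] using summable_besselSeries (add_pos ha one_pos) z
  refine hder.congr_deriv ?_
  rw [hsum.tsum_eq_zero_add]
  simp only [hshift]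
  simp [g', besselSeries]

theorem besselSeries_recurrence {a : ℝ} (ha : 0 < a) (z : ℝ) :
    besselSeries a z = a * besselSeries (a + 1) z + z * besselSeries (a + 1 + 1) z := by
  have h1 := summable_besselSeries (add_pos ha one_pos) z
  have h2 := summable_besselSeries (add_pos (add_pos ha one_pos) one_pos) z
  set f : ℕ → ℝ := fun n => n * z ^ n / (Nat.factorial n * Real.Gamma (n + (a + 1)))
  have hshift : ∀ n : ℕ, f (n + 1) =
      z * (z ^ n / (Nat.factorial n * Real.Gamma (n + (a + 1 + 1)))) := by
    intro n
    rw [← natCast_mul_pow_div_succ]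
    simp only [f]
    ring
  have hf : Summable f := by
    rw [← summable_nat_add_iff 1]
    simpa only [hshift] using h2.mul_left z
  have hftsum : ∑' n, f n = z * besselSeries (a + 1 + 1) z := by
    rw [hf.tsum_eq_zero_add]
    simp only [hshift, tsum_mul_left]
    simp [f, besselSeries]
  rw [← hftsum, besselSeries, besselSeries, ← tsum_mul_left, ← (h1.mul_left a).tsum_add hf]
  refine tsum_congr fun n => ?_
  have hpos : 0 < (n : ℝ) + a := by positivity
  have hG := Real.Gamma_pos_of_pos hpos
  simp only [f]
  rw [← add_assoc, Real.Gamma_add_one hpos.ne']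
  field_simp
  ring

theorem besselI_eq_besselSeries (ν x : ℝ) :
    besselI ν x = (x / 2) ^ ν * besselSeries (ν + 1) (x ^ 2 / 4) := by
  rw [besselI, besselSeries, ← tsum_mul_left]
  refine tsum_congr fun n => ?_
  rw [pow_mul, div_pow, add_assoc, mul_div_assoc]
  norm_num

/-- Solutions of `h'' = (1 + a / u²) h` grow at most like `eᵘ`, together with their derivative. -/
theorem exists_bound_of_hasDerivAt {a u₀ : ℝ} (hu₀ : 0 < u₀) {h k : ℝ → ℝ}
    (hh : ∀ u, 0 < u → HasDerivAt h (k u) u)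
    (hk : ∀ u, 0 < u → HasDerivAt k ((1 + a / u ^ 2) * h u) u) :
    ∃ K : ℝ, 0 < K ∧ ∀ u, u₀ ≤ u →
      |h u * Real.exp (-u)| ≤ K ∧ |(k u - h u) * Real.exp (-u)| ≤ K := by
  set W : ℝ → ℝ := fun u =>
    (((h u + k u) * Real.exp (-u)) ^ 2 + ((k u - h u) * Real.exp (-u)) ^ 2) *
      Real.exp (|a| * u⁻¹) with hW
  have hderiv : ∀ u, 0 < u → ∃ w, w ≤ 0 ∧ HasDerivAt W w u := by
    intro u hu
    have he : HasDerivAt (fun u : ℝ => Real.exp (-u)) (Real.exp (-u) * -1) u :=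
      (hasDerivAt_neg u).exp
    have hE := ((hh u hu).add (hk u hu)).mul he
    have hD := ((hk u hu).sub (hh u hu)).mul he
    have hx := ((hasDerivAt_inv hu.ne').const_mul |a|).exp
    refine ⟨_, ?_, ((hE.pow 2).add (hD.pow 2)).mul hx⟩
    simp only [Pi.add_apply, Pi.sub_apply, Pi.mul_apply, Pi.pow_apply]
    set e := Real.exp (-u)
    set r := Real.exp (|a| * u⁻¹)
    have hr : 0 < r := Real.exp_pos _
    have key : 0 ≤ (|a| - a) / u ^ 2 * ((h u + k u) * e) ^ 2 +
        ((|a| + a) / u ^ 2 + 4) * ((k u - h u) * e) ^ 2 := by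
      have h1 : 0 ≤ |a| - a := sub_nonneg.2 (le_abs_self a)
      have h2 : 0 ≤ |a| + a := by linarith [neg_abs_le a]
      positivity
    refine le_of_eq_of_le ?_ (neg_nonpos.2 (mul_nonneg key hr.le))
    field_simp
    ring
  have hanti : AntitoneOn W (Set.Ici u₀) := by
    have hd : ∀ u ∈ Set.Ici u₀, ∃ w, w ≤ 0 ∧ HasDerivAt W w u :=
      fun u hu => hderiv u (hu₀.trans_le hu)
    refine antitoneOn_of_deriv_nonpos (convex_Ici u₀) (fun u hu => ?_) (fun u hu => ?_)
      (fun u hu => ?_)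
    · obtain ⟨w, -, hw⟩ := hd u hu
      exact hw.continuousAt.continuousWithinAt
    · obtain ⟨w, -, hw⟩ := hd u (interior_subset hu)
      exact hw.differentiableAt.differentiableWithinAt
    · obtain ⟨w, hw0, hw⟩ := hd u (interior_subset hu)
      rwa [hw.deriv]
  have hW0 : 0 ≤ W u₀ := by positivity
  refine ⟨W u₀ + 1, by positivity, fun u hu => ?_⟩
  have hle : ((h u + k u) * Real.exp (-u)) ^ 2 + ((k u - h u) * Real.exp (-u)) ^ 2 ≤ W u₀ := by
    refine le_trans ?_ (hanti Set.self_mem_Ici hu hu)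
    have hupos := hu₀.trans_le hu
    exact le_mul_of_one_le_right (by positivity) (Real.one_le_exp (by positivity))
  have hid : h u * Real.exp (-u) =
      ((h u + k u) * Real.exp (-u) - (k u - h u) * Real.exp (-u)) / 2 := by ring
  rw [hid]
  set E := (h u + k u) * Real.exp (-u)
  set D := (k u - h u) * Real.exp (-u)
  constructor <;> refine abs_le_of_sq_le_sq ?_ (by positivity) <;>
    nlinarith [sq_nonneg (E + D), sq_nonneg E, sq_nonneg D]

theorem hasDerivAt_rpow_mul_besselSeries {a b u : ℝ} (ha : 0 < a) (hu : 0 < u) :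
    HasDerivAt (fun v : ℝ => v ^ b * besselSeries a (v ^ 2 / 4))
      (b * u ^ (b - 1) * besselSeries a (u ^ 2 / 4) +
        2⁻¹ * (u ^ (b + 1) * besselSeries (a + 1) (u ^ 2 / 4))) u := by
  have hq : HasDerivAt (fun v : ℝ => v ^ 2 / 4) (2 * u / 4) u := by
    simpa using (hasDerivAt_pow 2 u).div_const 4
  have hs : HasDerivAt (fun v : ℝ => besselSeries a (v ^ 2 / 4))
      (besselSeries (a + 1) (u ^ 2 / 4) * (2 * u / 4)) u :=
    HasDerivAt.comp (h₂ := besselSeries a) u (hasDerivAt_besselSeries ha (u ^ 2 / 4)) hq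
  refine ((Real.hasDerivAt_rpow_const (p := b) (Or.inl hu.ne')).mul hs).congr_deriv ?_
  rw [Real.rpow_add_one hu.ne']
  ring

theorem exists_bound_sqrt_mul_besselI_mul_exp {β : ℝ} (hβ : 0 < β) {u₀ : ℝ} (hu₀ : 0 < u₀) :
    ∃ K : ℝ, 0 < K ∧ ∃ p p' : ℝ → ℝ, (∀ u, 0 < u →
      p u = u ^ (1 / 2 : ℝ) * besselI (β - 1 / 2) u * Real.exp (-u) ∧ HasDerivAt p (p' u) u) ∧
      ∀ u, u₀ ≤ u → |p u| ≤ K ∧ |p' u| ≤ K := by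
  set a := β + 1 / 2 with ha_def
  have ha : 0 < a := by positivity
  set s : ℝ := 2⁻¹ ^ (β - 1 / 2)
  set h : ℝ → ℝ := fun u => s * (u ^ β * besselSeries a (u ^ 2 / 4))
  set k : ℝ → ℝ := fun u => s * (β * (u ^ (β - 1) * besselSeries a (u ^ 2 / 4)) +
    2⁻¹ * (u ^ (β + 1) * besselSeries (a + 1) (u ^ 2 / 4)))
  have hh : ∀ u, 0 < u → HasDerivAt h (k u) u := by
    intro u hu
    refine ((hasDerivAt_rpow_mul_besselSeries (b := β) ha hu).const_mul s).congr_deriv ?_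
    simp only [k]
    ring
  have hk : ∀ u, 0 < u → HasDerivAt k ((1 + β * (β - 1) / u ^ 2) * h u) u := by
    intro u hu
    refine ((((hasDerivAt_rpow_mul_besselSeries (b := β - 1) ha hu).const_mul β).add
      ((hasDerivAt_rpow_mul_besselSeries (b := β + 1) (add_pos ha one_pos) hu).const_mul
        2⁻¹)).const_mul s).congr_deriv ?_
    simp only [h]
    rw [besselSeries_recurrence ha]
    have e1 : u ^ (β - 1 - 1) = u ^ β / u ^ 2 := by
      rw [Real.rpow_sub_one hu.ne', Real.rpow_sub_one hu.ne']
      field_simp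
    have e2 : u ^ (β + 1 + 1) = u ^ β * u ^ 2 := by
      rw [Real.rpow_add_one hu.ne', Real.rpow_add_one hu.ne']
      ring
    simp only [sub_add_cancel, add_sub_cancel_right, e1, e2, ha_def]
    field_simp
    ring
  obtain ⟨K, hK, hb⟩ := exists_bound_of_hasDerivAt hu₀ hh hk
  refine ⟨K, hK, fun u => h u * Real.exp (-u), fun u => (k u - h u) * Real.exp (-u),
    fun u hu => ⟨?_, ?_⟩, hb⟩
  · have hpow : u ^ β = u ^ (1 / 2 : ℝ) * u ^ (β - 1 / 2) := by
      rw [← Real.rpow_add hu]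
      ring_nf
    have hidx : β - 1 / 2 + 1 = a := by rw [ha_def]; ring
    simp only [h, s]
    rw [besselI_eq_besselSeries, hidx, hpow, div_eq_mul_inv u,
      Real.mul_rpow hu.le (by norm_num : (0 : ℝ) ≤ 2⁻¹)]
    ring
  · refine ((hh u hu).mul (hasDerivAt_neg u).exp).congr_deriv ?_
    ring

theorem TB_eq_mul_exp (β : ℝ) {t x y : ℝ} (ht : 0 < t) (hx : 0 < x) (hy : 0 < y) :
    TB β t x y = (2 * t) ^ (1 / 2 : ℝ) / (2 * t) *
      ((x * y / (2 * t)) ^ (1 / 2 : ℝ) * besselI (β - 1 / 2) (x * y / (2 * t)) *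
        Real.exp (-(x * y / (2 * t))) * Real.exp (-(x - y) ^ 2 / (4 * t))) := by
  have hexp : Real.exp (-(x ^ 2 + y ^ 2) / (4 * t)) =
      Real.exp (-(x * y / (2 * t))) * Real.exp (-(x - y) ^ 2 / (4 * t)) := by
    rw [← Real.exp_add]
    congr 1
    field_simp
    ring
  have hpow : (x * y) ^ (1 / 2 : ℝ) =
      (2 * t) ^ (1 / 2 : ℝ) * (x * y / (2 * t)) ^ (1 / 2 : ℝ) := by
    rw [← Real.mul_rpow (by positivity) (by positivity)]
    congr 1
    field_simp
  rw [TB, hexp, hpow]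
  ring

theorem two_mul_rpow_half_div_le {t : ℝ} (ht : 0 < t) :
    (2 * t) ^ (1 / 2 : ℝ) / (2 * t) ≤ t / t ^ (3 / 2 : ℝ) := by
  have h32 : t ^ (3 / 2 : ℝ) = t * t ^ (1 / 2 : ℝ) := by
    rw [← Real.rpow_one_add' ht.le (by norm_num)]
    norm_num
  have hsq : t ^ (1 / 2 : ℝ) * t ^ (1 / 2 : ℝ) = t := by
    rw [← Real.rpow_add ht]
    norm_num
  have htwo : (2 : ℝ) ^ (1 / 2 : ℝ) ≤ 2 :=
    Real.rpow_le_self_of_one_le (by norm_num) (by norm_num)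
  have hpos : 0 < t ^ (1 / 2 : ℝ) := by positivity
  rw [h32, Real.mul_rpow (by norm_num) ht.le, div_le_div_iff₀ (by positivity) (by positivity)]
  calc (2 : ℝ) ^ (1 / 2 : ℝ) * t ^ (1 / 2 : ℝ) * (t * t ^ (1 / 2 : ℝ))
      = 2 ^ (1 / 2 : ℝ) * (t ^ (1 / 2 : ℝ) * t ^ (1 / 2 : ℝ)) * t := by ring
    _ ≤ 2 * t * t := by rw [hsq]; gcongr
    _ = t * (2 * t) := by ring

theorem bessel_kernel_derivative_bound_large (β : ℝ) (hβ : 0 < β) :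
    ∃ C c : ℝ, 0 < C ∧ 0 < c ∧ ∀ t x y : ℝ, 0 < t → 0 < x → 0 < y → t ≤ x*y →
      |deriv (fun x' => TB β t x' y) x| ≤
        C * (x + y) / t ^ ((3:ℝ)/2) * Real.exp (-|x-y|^2 / (c*t)) := by
  obtain ⟨K, hK, p, p', hp, hb⟩ :=
    exists_bound_sqrt_mul_besselI_mul_exp hβ (u₀ := 1 / 2) (by norm_num)
  refine ⟨K, 4, hK, by norm_num, fun t x y ht hx hy hxy => ?_⟩
  have hu : 1 / 2 ≤ x * y / (2 * t) := by
    rw [div_le_div_iff₀ (by norm_num) (by positivity)]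
    linarith
  obtain ⟨hbp, hbp'⟩ := hb _ hu
  have heq : (fun x' => TB β t x' y) =ᶠ[nhds x] fun x' =>
      (2 * t) ^ (1 / 2 : ℝ) / (2 * t) *
        (p (x' * y / (2 * t)) * Real.exp (-(x' - y) ^ 2 / (4 * t))) := by
    filter_upwards [lt_mem_nhds hx] with w hw
    rw [TB_eq_mul_exp β ht hw hy, (hp _ (by positivity)).1]
  have hlin : HasDerivAt (fun w : ℝ => w * y / (2 * t)) (1 * y / (2 * t)) x :=
    ((hasDerivAt_id x).mul_const y).div_const _
  have hpc : HasDerivAt (fun w : ℝ => p (w * y / (2 * t)))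
      (p' (x * y / (2 * t)) * (1 * y / (2 * t))) x :=
    (hp _ (by positivity)).2.comp x hlin
  have hquad : HasDerivAt (fun w : ℝ => -(w - y) ^ 2 / (4 * t)) (-(2 * (x - y)) / (4 * t)) x := by
    simpa using ((((hasDerivAt_id x).sub_const y).pow 2).neg.div_const (4 * t))
  have hder := ((hpc.mul hquad.exp).const_mul ((2 * t) ^ (1 / 2 : ℝ) / (2 * t)))
    |>.congr_of_eventuallyEq heq
  rw [hder.deriv, sq_abs]
  set e := Real.exp (-(x - y) ^ 2 / (4 * t))
  set P := p (x * y / (2 * t))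
  set P' := p' (x * y / (2 * t))
  have hfac : P' * (1 * y / (2 * t)) * e + P * (e * (-(2 * (x - y)) / (4 * t))) =
      (P' * y - P * (x - y)) / (2 * t) * e := by
    field_simp
    ring
  have hnum : |P' * y - P * (x - y)| ≤ 2 * K * (x + y) := by
    have hsub : |x - y| ≤ x + y := abs_le.2 ⟨by linarith, by linarith⟩
    calc |P' * y - P * (x - y)| ≤ |P'| * y + |P| * |x - y| := by
          refine (abs_sub _ _).trans_eq ?_
          rw [abs_mul, abs_mul, abs_of_pos hy]
      _ ≤ K * (x + y) + K * (x + y) := by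
          gcongr
          linarith
      _ = 2 * K * (x + y) := by ring
  rw [hfac, abs_mul, abs_mul, abs_of_pos (by positivity : 0 < (2 * t) ^ (1 / 2 : ℝ) / (2 * t)),
    abs_div, abs_of_pos (by positivity : 0 < 2 * t), abs_of_pos (Real.exp_pos _ : 0 < e)]
  calc (2 * t) ^ (1 / 2 : ℝ) / (2 * t) * (|P' * y - P * (x - y)| / (2 * t) * e)
      ≤ t / t ^ (3 / 2 : ℝ) * (2 * K * (x + y) / (2 * t) * e) := by
        refine mul_le_mul (two_mul_rpow_half_div_le ht) ?_ (by positivity) (by positivity)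
        gcongr
    _ = K * (x + y) / t ^ (3 / 2 : ℝ) * e := by
        field_simp
end

section
/- Let β > 0 and y > 0. Then ∫_0^∞ T_t(x,y) t^{-1/2} dt ≤ C ln(y/|x-y|) for all x > 0 with |x-y| ≤ y/2, where T_t is the Bessel heat kernel T_t(x,y) = (xy)^{1/2}/(2t) I_{β-1/2}(xy/(2t)) exp(-(x²+y²)/(4t)) and C depends only on β. -/
open Real Set MeasureTheory

/-- The inverse-Gamma integral. -/
lemma integral_rpow_mul_exp_neg_div {a c : ℝ} (ha : 0 < a) (hc : 0 < c) :
    ∫ t in Ioi (0:ℝ), t ^ (-a - 1) * Real.exp (-c / t) = (1 / c) ^ a * Real.Gamma a := by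
  rw [← Real.integral_rpow_mul_exp_neg_mul_Ioi ha hc,
    ← integral_comp_rpow_Ioi (fun u : ℝ => u ^ (a - 1) * Real.exp (-(c * u)))
      (p := -1) (by norm_num)]
  refine setIntegral_congr_fun measurableSet_Ioi fun t ht => ?_
  have ht : (0:ℝ) < t := ht
  simp only [smul_eq_mul, abs_neg, abs_one, one_mul]
  rw [← Real.rpow_mul ht.le, ← mul_assoc, ← Real.rpow_add ht, Real.rpow_neg_one, neg_div,
    div_eq_mul_inv]
  ring_nf

lemma integrableOn_rpow_mul_exp_neg_div {a c : ℝ} (ha : 0 < a) (hc : 0 < c) :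
    IntegrableOn (fun t : ℝ => t ^ (-a - 1) * Real.exp (-c / t)) (Ioi 0) := by
  by_contra h
  have h0 := integral_undef h
  rw [integral_rpow_mul_exp_neg_div ha hc] at h0
  have := Real.Gamma_pos_of_pos ha
  have : 0 < (1 / c) ^ a * Real.Gamma a := by positivity
  exact this.ne' h0

/-- The coefficients of the time integral of the Bessel heat kernel, as a power series. -/
noncomputable def timeCoeff (β : ℝ) (n : ℕ) : ℝ :=
  Real.Gamma (β + 2 * n) / (4 ^ n * (Nat.factorial n * Real.Gamma (n + (β - 1 / 2) + 1)))

lemma Gamma_order_pos {β : ℝ} (hβ : 0 < β) (n : ℕ) :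
    0 < Real.Gamma (n + (β - 1 / 2) + 1) :=
  Real.Gamma_pos_of_pos (by have : (0:ℝ) ≤ n := n.cast_nonneg; linarith)

lemma timeCoeff_pos {β : ℝ} (hβ : 0 < β) (n : ℕ) : 0 < timeCoeff β n := by
  have h1 := Gamma_order_pos hβ n
  have h2 : 0 < Real.Gamma (β + 2 * n) := Real.Gamma_pos_of_pos (by positivity)
  unfold timeCoeff
  positivity

lemma timeCoeff_succ {β : ℝ} (hβ : 0 < β) (n : ℕ) :
    timeCoeff β (n + 1) * ((n + 1) * (n + β + 1 / 2)) =
      timeCoeff β n * ((n + β / 2) * (n + β / 2 + 1 / 2)) := by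
  have hn : (0:ℝ) ≤ n := n.cast_nonneg
  have h1 : Real.Gamma (β + 2 * (n + 1 : ℕ)) =
      (β + 2 * n + 1) * ((β + 2 * n) * Real.Gamma (β + 2 * n)) := by
    rw [← Real.Gamma_add_one (by positivity), ← Real.Gamma_add_one (by positivity)]
    push_cast
    ring_nf
  have h2 : Real.Gamma ((n + 1 : ℕ) + (β - 1 / 2) + 1) =
      (n + β + 1 / 2) * Real.Gamma (n + (β - 1 / 2) + 1) := by
    rw [show (n:ℝ) + β + 1 / 2 = n + (β - 1 / 2) + 1 by ring,
      ← Real.Gamma_add_one (by linarith)]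
    push_cast
    ring_nf
  have h3 := (Gamma_order_pos hβ n).ne'
  have h4 : (n:ℝ) + β + 1 / 2 ≠ 0 := by positivity
  unfold timeCoeff
  rw [h1, h2, Nat.factorial_succ]
  set G := Real.Gamma (n + (β - 1 / 2) + 1)
  push_cast
  field_simp
  ring

lemma timeCoeff_lower {β : ℝ} (hβ : 0 < β) (n : ℕ) :
    β / 4 * timeCoeff β 0 ≤ (n + β / 4) * timeCoeff β n := by
  induction n with
  | zero => simp
  | succ n ih =>
    refine ih.trans ?_
    have hn : (0:ℝ) ≤ n := n.cast_nonneg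
    have hb := timeCoeff_pos hβ n
    have hD : (0:ℝ) < (n + 1) * (n + β + 1 / 2) := by positivity
    refine le_of_mul_le_mul_right ?_ hD
    push_cast
    rw [mul_assoc ((n:ℝ) + 1 + β / 4), timeCoeff_succ hβ n]
    have : ((n:ℝ) + β / 4) * ((n + 1) * (n + β + 1 / 2)) ≤
        (n + 1 + β / 4) * ((n + β / 2) * (n + β / 2 + 1 / 2)) := by
      have : 0 ≤ β ^ 2 * n := by positivity
      have : 0 ≤ β ^ 3 := by positivity
      have : 0 ≤ β ^ 2 := by positivity
      nlinarith
    nlinarith [mul_le_mul_of_nonneg_left this hb.le]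

lemma timeCoeff_upper {β : ℝ} (hβ : 0 < β) :
    ∃ C : ℝ, 0 < C ∧ ∀ n : ℕ, timeCoeff β n ≤ C / (n + 1) := by
  obtain ⟨q, hq⟩ : ∃ q, q = (β ^ 2 + β) / 4 := ⟨_, rfl⟩
  have hq0 : 0 < q := by rw [hq]; positivity
  obtain ⟨N, hN⟩ := exists_nat_ge (q * (2 + q))
  set c : ℕ → ℝ := fun n => (n + (q + 1)) * timeCoeff β n with hc
  have hcpos : ∀ n, 0 < c n := fun n => by
    have := timeCoeff_pos hβ n
    simp only [hc]
    positivity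
  have hanti : ∀ n, N ≤ n → c n ≤ c N := by
    intro n hn
    induction n, hn using Nat.le_induction with
    | base => exact le_rfl
    | succ n hn ih =>
      refine le_trans ?_ ih
      have hn' : q * (2 + q) ≤ n := hN.trans (by exact_mod_cast hn)
      have hn0 : (0:ℝ) ≤ n := n.cast_nonneg
      have hb := timeCoeff_pos hβ n
      have hD : (0:ℝ) < (n + 1) * (n + β + 1 / 2) := by positivity
      refine le_of_mul_le_mul_right ?_ hD
      simp only [hc]
      push_cast
      rw [mul_assoc ((n:ℝ) + 1 + (q + 1)), timeCoeff_succ hβ n]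
      have h5 : ((n:ℝ) + β / 2) * (n + β / 2 + 1 / 2) = n ^ 2 + (β + 1 / 2) * n + q := by
        rw [hq]; ring
      have h6 : 0 < (q + 1) * (β + 1 / 2) := by positivity
      have : ((n:ℝ) + 1 + (q + 1)) * ((n + β / 2) * (n + β / 2 + 1 / 2)) ≤
          (n + (q + 1)) * ((n + 1) * (n + β + 1 / 2)) := by
        rw [h5]
        nlinarith
      nlinarith [mul_le_mul_of_nonneg_left this hb.le]
  have hle : ∀ n, c n ≤ ∑ i ∈ Finset.range (N + 1), c i := by
    intro n
    rcases le_total N n with h | h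
    · exact (hanti n h).trans
        (Finset.single_le_sum (fun i _ => (hcpos i).le) (by simp))
    · exact Finset.single_le_sum (fun i _ => (hcpos i).le) (by simp; omega)
  refine ⟨_, (hcpos 0).trans_le (hle 0), fun n => ?_⟩
  rw [le_div_iff₀ (by positivity)]
  refine le_trans ?_ (hle n)
  have hb := timeCoeff_pos hβ n
  simp only [hc]
  nlinarith [mul_pos hq0 hb]

lemma summable_besselI {β z : ℝ} (hβ : 0 < β) (hz : 0 < z) :
    Summable fun n : ℕ => (z / 2) ^ (β - 1 / 2) * (z / 2) ^ (2 * n) /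
      (Nat.factorial n * Real.Gamma (n + (β - 1 / 2) + 1)) := by
  have hΓ0 : 0 < Real.Gamma (β + 1 / 2) := Real.Gamma_pos_of_pos (by positivity)
  have hΓ : ∀ n : ℕ, Real.Gamma (β + 1 / 2) * (1 / 2) ^ n ≤
      Real.Gamma (n + (β - 1 / 2) + 1) := by
    intro n
    induction n with
    | zero =>
      refine le_of_eq ?_
      simp only [pow_zero, mul_one, Nat.cast_zero]
      ring_nf
    | succ n ih =>
      have h := Gamma_order_pos hβ n
      have hn : (0:ℝ) ≤ n := n.cast_nonneg
      have : Real.Gamma ((n + 1 : ℕ) + (β - 1 / 2) + 1) =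
          (n + (β - 1 / 2) + 1) * Real.Gamma (n + (β - 1 / 2) + 1) := by
        rw [← Real.Gamma_add_one (by linarith)]
        push_cast
        ring_nf
      rw [this, pow_succ]
      nlinarith
  refine Summable.of_nonneg_of_le (fun n => ?_) (fun n => ?_)
    ((Real.summable_pow_div_factorial ((z / 2) ^ 2 * 2)).mul_left
      ((z / 2) ^ (β - 1 / 2) / Real.Gamma (β + 1 / 2)))
  · have := Gamma_order_pos hβ n
    positivity
  · have h2 : (z / 2) ^ (β - 1 / 2) / Real.Gamma (β + 1 / 2) *
        (((z / 2) ^ 2 * 2) ^ n / (Nat.factorial n : ℝ)) =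
        (z / 2) ^ (β - 1 / 2) * (z / 2) ^ (2 * n) /
          (Nat.factorial n * (Real.Gamma (β + 1 / 2) * (1 / 2) ^ n)) := by
      rw [mul_pow, ← pow_mul, one_div_pow]
      field_simp
    rw [h2]
    have := hΓ n
    gcongr

/-- The terms of the series of `TB β t x y * t ^ (-1/2)`. -/
noncomputable def timeTerm (β x y : ℝ) (n : ℕ) (t : ℝ) : ℝ :=
  (x * y) ^ ((1:ℝ) / 2) / 2 * ((x * y / 4) ^ (β - 1 / 2 + 2 * n)) /
    (Nat.factorial n * Real.Gamma (n + (β - 1 / 2) + 1)) *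
    (t ^ (-(β + 2 * n) - 1) * Real.exp (-((x ^ 2 + y ^ 2) / 4) / t))

lemma timeTerm_nonneg {β x y t : ℝ} (hβ : 0 < β) (hx : 0 < x) (hy : 0 < y) (ht : 0 < t)
    (n : ℕ) : 0 ≤ timeTerm β x y n t := by
  have := Gamma_order_pos hβ n
  unfold timeTerm
  positivity

lemma timeTerm_eq {β x y t : ℝ} (hx : 0 < x) (hy : 0 < y) (ht : 0 < t) (n : ℕ) :
    timeTerm β x y n t =
      (x * y) ^ ((1:ℝ) / 2) / (2 * t) * Real.exp (-(x ^ 2 + y ^ 2) / (4 * t)) *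
        t ^ (-(1:ℝ) / 2) *
      ((x * y / (2 * t) / 2) ^ (β - 1 / 2) * (x * y / (2 * t) / 2) ^ (2 * n) /
        (Nat.factorial n * Real.Gamma (n + (β - 1 / 2) + 1))) := by
  have hxy : 0 < x * y := mul_pos hx hy
  have h1 : (x * y / (2 * t) / 2) ^ (β - 1 / 2) * (x * y / (2 * t) / 2) ^ (2 * n) =
      (x * y / 4) ^ (β - 1 / 2 + 2 * n) * t ^ (-(β - 1 / 2 + 2 * n)) := by
    rw [← Real.rpow_natCast (x * y / (2 * t) / 2), ← Real.rpow_add (by positivity),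
      show x * y / (2 * t) / 2 = x * y / 4 / t by field_simp; norm_num,
      Real.div_rpow (by positivity) ht.le, Real.rpow_neg ht.le]
    push_cast
    rfl
  have h2 : t ^ (-(β + 2 * n) - 1) =
      t ^ (-(β - 1 / 2 + 2 * n)) * t ^ (-(1:ℝ) / 2) * t⁻¹ := by
    rw [← Real.rpow_neg_one, ← Real.rpow_add ht, ← Real.rpow_add ht]
    ring_nf
  have h3 : -((x ^ 2 + y ^ 2) / 4) / t = -(x ^ 2 + y ^ 2) / (4 * t) := by
    field_simp
  rw [timeTerm, h1, h2, h3]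
  ring

lemma hasSum_timeTerm {β x y t : ℝ} (hβ : 0 < β) (hx : 0 < x) (hy : 0 < y) (ht : 0 < t) :
    HasSum (fun n => timeTerm β x y n t) (TB β t x y * t ^ (-(1:ℝ) / 2)) := by
  have h := ((summable_besselI hβ (z := x * y / (2 * t)) (by positivity)).hasSum).mul_left
    ((x * y) ^ ((1:ℝ) / 2) / (2 * t) * Real.exp (-(x ^ 2 + y ^ 2) / (4 * t)) *
        t ^ (-(1:ℝ) / 2))
  simp only [← timeTerm_eq hx hy ht] at h
  have hTB : TB β t x y * t ^ (-(1:ℝ) / 2) =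
      (x * y) ^ ((1:ℝ) / 2) / (2 * t) * Real.exp (-(x ^ 2 + y ^ 2) / (4 * t)) *
        t ^ (-(1:ℝ) / 2) * besselI (β - 1 / 2) (x * y / (2 * t)) := by
    unfold TB
    ring
  rw [hTB]
  exact h

lemma integrableOn_timeTerm {β x y : ℝ} (hβ : 0 < β) (hx : 0 < x) (n : ℕ) :
    IntegrableOn (timeTerm β x y n) (Ioi 0) :=
  (integrableOn_rpow_mul_exp_neg_div (by positivity) (by positivity)).const_mul _

lemma integral_timeTerm {β x y : ℝ} (hβ : 0 < β) (hx : 0 < x) (hy : 0 < y) (n : ℕ) :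
    ∫ t in Ioi (0:ℝ), timeTerm β x y n t =
      (x * y / (x ^ 2 + y ^ 2)) ^ β *
        (timeCoeff β n * ((2 * x * y / (x ^ 2 + y ^ 2)) ^ 2) ^ n) := by
  have hxy : 0 < x * y := mul_pos hx hy
  have hS : 0 < x ^ 2 + y ^ 2 := by positivity
  unfold timeTerm
  rw [integral_const_mul, integral_rpow_mul_exp_neg_div (by positivity) (by positivity)]
  have h1 : (x * y / 4) ^ (β - 1 / 2 + 2 * n) =
      (x * y / 4) ^ (β + 2 * n) * (2 / (x * y) ^ ((1:ℝ) / 2)) := by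
    rw [show β - 1 / 2 + 2 * (n:ℝ) = (β + 2 * n) - 1 / 2 by ring,
      Real.rpow_sub (by positivity), Real.div_rpow hxy.le (by norm_num) (1 / 2),
      show (4:ℝ) = 2 ^ (2:ℝ) by norm_num, ← Real.rpow_mul (by norm_num) 2 (1 / 2)]
    norm_num
    field_simp
  have h2 : (x * y / 4) ^ (β + 2 * n) * (1 / ((x ^ 2 + y ^ 2) / 4)) ^ (β + 2 * n) =
      (x * y / (x ^ 2 + y ^ 2)) ^ β * (x * y / (x ^ 2 + y ^ 2)) ^ (2 * n) := by
    rw [← Real.mul_rpow (by positivity) (by positivity), ← Real.rpow_natCast _ (2 * n),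
      ← Real.rpow_add (by positivity)]
    congr 1
    · field_simp
    · push_cast; rfl
  have h3 : ((2 * x * y / (x ^ 2 + y ^ 2)) ^ 2) ^ n =
      4 ^ n * (x * y / (x ^ 2 + y ^ 2)) ^ (2 * n) := by
    rw [pow_mul, ← mul_pow]
    congr 1
    ring
  have h4 : (x * y) ^ ((1:ℝ) / 2) ≠ 0 := by positivity
  have h5 := (Gamma_order_pos hβ n).ne'
  rw [h3, timeCoeff, h1]
  calc _ = ((x * y) ^ ((1:ℝ) / 2) / 2 * (2 / (x * y) ^ ((1:ℝ) / 2))) *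
        ((x * y / 4) ^ (β + 2 * n) * (1 / ((x ^ 2 + y ^ 2) / 4)) ^ (β + 2 * n)) *
        (Real.Gamma (β + 2 * n) / (Nat.factorial n * Real.Gamma (n + (β - 1 / 2) + 1))) := by
        ring
    _ = _ := by
        rw [h2]
        set G := Real.Gamma (n + (β - 1 / 2) + 1)
        field_simp

/-- On the diagonal the time integral diverges. -/
lemma not_integrableOn_diag {β x : ℝ} (hβ : 0 < β) (hx : 0 < x) :
    ¬ IntegrableOn (fun t => TB β t x x * t ^ (-(1:ℝ) / 2)) (Ioi 0) := by
  intro hInt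
  set w := (x * x / (x ^ 2 + x ^ 2)) ^ β with hw
  have hw0 : 0 < w := by positivity
  have hr : 2 * x * x / (x ^ 2 + x ^ 2) = 1 := by field_simp; norm_num
  have hterm : ∀ n, ∫ t in Ioi (0:ℝ), timeTerm β x x n t = w * timeCoeff β n := by
    intro n
    rw [integral_timeTerm hβ hx hx, hr]
    simp [hw]
  have hsum : Summable fun n => w * timeCoeff β n := by
    refine summable_of_sum_range_le
      (c := ∫ t in Ioi (0:ℝ), TB β t x x * t ^ (-(1:ℝ) / 2))
      (fun n => (mul_pos hw0 (timeCoeff_pos hβ n)).le) fun N => ?_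
    simp_rw [← hterm]
    rw [← integral_finsetSum _ fun n _ => integrableOn_timeTerm hβ hx n]
    refine setIntegral_mono_on (integrable_finsetSum _ fun n _ => integrableOn_timeTerm hβ hx n)
      hInt measurableSet_Ioi fun t ht => ?_
    exact sum_le_hasSum _ (fun n _ => timeTerm_nonneg hβ hx hx ht n)
      (hasSum_timeTerm hβ hx hx ht)
  have hsum' : Summable (timeCoeff β) := (summable_mul_left_iff hw0.ne').1 hsum
  have hc : 0 < β / 4 * timeCoeff β 0 := by
    have := timeCoeff_pos hβ 0
    positivity
  have hharm : Summable fun n : ℕ => 1 / ((n:ℝ) + 1) := by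
    refine Summable.of_nonneg_of_le (fun n => by positivity) (fun n => ?_)
      (hsum'.mul_left ((β / 4 + 1) / (β / 4 * timeCoeff β 0)))
    have h := timeCoeff_lower hβ n
    have hb := timeCoeff_pos hβ n
    have hn : (0:ℝ) ≤ n := n.cast_nonneg
    rw [div_mul_eq_mul_div, div_le_div_iff₀ (by positivity) hc, one_mul]
    refine h.trans ?_
    have : (n:ℝ) + β / 4 ≤ (β / 4 + 1) * (n + 1) := by nlinarith
    nlinarith [mul_le_mul_of_nonneg_left this hb.le]
  exact Real.not_summable_one_div_natCast ((summable_nat_add_iff 1).1 (by simpa using hharm))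

theorem bessel_time_integral_near_diag (β : ℝ) (hβ : 0 < β) :
    ∃ C : ℝ, ∀ y : ℝ, 0 < y → ∀ x : ℝ, 0 < x → |x - y| ≤ y/2 →
      ∫ t in Ioi (0:ℝ), TB β t x y * t ^ (-(1:ℝ)/2) ≤ C * Real.log (y / |x - y|) := by
  obtain ⟨C, hC, hb⟩ := timeCoeff_upper hβ
  refine ⟨C * (13 / 4) * 4, fun y hy x hx hxy => ?_⟩
  rcases eq_or_ne x y with rfl | hne
  · rw [integral_undef (not_integrableOn_diag hβ hx)]
    simp
  have hS : 0 < x ^ 2 + y ^ 2 := by positivity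
  have hd : 0 < |x - y| := abs_pos.2 (sub_ne_zero.2 hne)
  obtain ⟨hl, hu⟩ := abs_le.1 hxy
  have hS' : x ^ 2 + y ^ 2 ≤ 13 / 4 * y ^ 2 := by nlinarith
  set w := (x * y / (x ^ 2 + y ^ 2)) ^ β with hw
  set r := 2 * x * y / (x ^ 2 + y ^ 2) with hr
  have hw0 : 0 < w := by positivity
  have hr0 : 0 < r := by positivity
  have h1r : 1 - r = |x - y| ^ 2 / (x ^ 2 + y ^ 2) := by
    rw [hr, sq_abs]
    field_simp
    ring
  have hr1 : r < 1 := by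
    have : 0 < 1 - r := by rw [h1r]; positivity
    linarith
  have hrl : 1 ≤ 13 / 4 * r := by
    rw [hr, ← mul_div_assoc, le_div_iff₀ hS]
    nlinarith
  have hw1 : w ≤ 1 := by
    refine Real.rpow_le_one (by positivity) ?_ hβ.le
    rw [div_le_one hS]
    nlinarith [sq_nonneg (x - y)]
  have hlog := Real.hasSum_pow_div_log_of_abs_lt_one (x := r) (by rwa [abs_of_pos hr0])
  have hbound : ∀ n, w * (timeCoeff β n * (r ^ 2) ^ n) ≤
      C * (13 / 4) * (r ^ (n + 1) / (n + 1)) := by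
    intro n
    have hb0 := timeCoeff_pos hβ n
    have h1 : (r ^ 2) ^ n ≤ r ^ n := pow_le_pow_left₀ (by positivity) (by nlinarith) n
    have h2 : r ^ n ≤ 13 / 4 * r ^ (n + 1) := by
      rw [pow_succ]
      nlinarith [pow_pos hr0 n]
    calc w * (timeCoeff β n * (r ^ 2) ^ n) ≤ 1 * (C / (n + 1) * (13 / 4 * r ^ (n + 1))) := by
          gcongr
          · exact hb n
          · exact h1.trans h2
      _ = _ := by ring
  have hbsum : Summable fun n => w * (timeCoeff β n * (r ^ 2) ^ n) := by
    refine Summable.of_nonneg_of_le (fun n => ?_) hbound (hlog.summable.mul_left _)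
    have := timeCoeff_pos hβ n
    positivity
  have hnorm : ∀ n, ∫ t in Ioi (0:ℝ), ‖timeTerm β x y n t‖ =
      w * (timeCoeff β n * (r ^ 2) ^ n) := by
    intro n
    rw [← integral_timeTerm hβ hx hy n]
    exact setIntegral_congr_fun measurableSet_Ioi fun t ht =>
      Real.norm_of_nonneg (timeTerm_nonneg hβ hx hy ht n)
  have hI := hasSum_integral_of_summable_integral_norm
    (μ := volume.restrict (Ioi (0:ℝ))) (fun n => integrableOn_timeTerm (y := y) hβ hx n)
    (by simpa only [hnorm] using hbsum)
  have hcongr : ∫ t in Ioi (0:ℝ), TB β t x y * t ^ (-(1:ℝ)/2) =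
      ∫ t in Ioi (0:ℝ), ∑' n, timeTerm β x y n t :=
    setIntegral_congr_fun measurableSet_Ioi fun t ht =>
      (hasSum_timeTerm hβ hx hy ht).tsum_eq.symm
  simp only [integral_timeTerm hβ hx hy] at hI
  have hle := hasSum_le hbound hI (hlog.mul_left _)
  rw [hcongr]
  refine hle.trans ?_
  rw [mul_assoc _ (4:ℝ)]
  refine mul_le_mul_of_nonneg_left ?_ (by positivity)
  rw [← Real.log_inv, h1r, inv_div]
  have h2 : 2 ≤ y / |x - y| := by
    rw [le_div_iff₀ hd]
    linarith
  have h4 : (4:ℝ) * Real.log (y / |x - y|) = Real.log ((y / |x - y|) ^ 4) := by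
    rw [Real.log_pow]
    norm_num
  rw [h4]
  refine Real.log_le_log (by positivity) ?_
  have h5 : (x ^ 2 + y ^ 2) / |x - y| ^ 2 ≤ 13 / 4 * (y / |x - y|) ^ 2 := by
    rw [div_pow, ← mul_div_assoc]
    gcongr
  refine h5.trans ?_
  have h6 : (13 / 4 : ℝ) ≤ (y / |x - y|) ^ 2 := by nlinarith
  nlinarith [sq_nonneg (y / |x - y|)]
end
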